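/- arXiv:2508.19108 — 6 statements merged into one kernel-verified Lean document; each statement's English description precedes it below -/
import Mathlib

section
/- Let γ⁰, γ¹, γ², γ³ be a 4D gamma representation on ℂ^N. For all real numbers E, q and all real antisymmetric J_{IJ} (I,J ∈ {1,2,3}), the Hermitian matrix E·1 + i(J₁₂ γ⁰γ¹γ² + J₁₃ γ⁰γ¹γ³ + J₂₃ γ⁰γ²γ³) − q·γ⁰ is positive semidefinite if and only if E ≥ |q| + √(J₁₂² + J₁₃² + J₂₃²). -/
open Matrix
open scoped ComplexOrder

/-- A 4D gamma representation on `ℂ^N`: matrices `γ 0, γ 1, γ 2, γ 3` satisfying the Clifford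
relations `γ a * γ b + γ b * γ a = -2 η a b • 1` with `η = diag (-1,1,1,1)`, with `γ 0`
Hermitian and `γ 1, γ 2, γ 3` anti-Hermitian. -/
def IsGammaRep4 {N : ℕ} (γ : Fin 4 → Matrix (Fin N) (Fin N) ℂ) : Prop :=
  (∀ a b, γ a * γ b + γ b * γ a =
      if a = b then ((-2 : ℂ) * (if a = 0 then -1 else 1)) • (1 : Matrix (Fin N) (Fin N) ℂ)
      else 0) ∧
  (γ 0)ᴴ = γ 0 ∧ ∀ a : Fin 4, a ≠ 0 → (γ a)ᴴ = -γ a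

set_option linter.unusedSimpArgs false

lemma aux_one_add {N : ℕ} (X : Matrix (Fin N) (Fin N) ℂ) (h : Xᴴ = X) (h2 : X * X = 1) :
    (1 + X).PosSemidef := by
  have h1 : ((1 + X)ᴴ * (1 + X)).PosSemidef := posSemidef_conjTranspose_mul_self _
  have h3 : (1 + X) = ((1 / 2 : ℝ) : ℂ) • ((1 + X)ᴴ * (1 + X)) := by
    rw [conjTranspose_add, h, conjTranspose_one, mul_add, add_mul, add_mul, h2]
    simp only [one_mul, mul_one]
    push_cast
    module
  rw [h3]
  refine h1.smul ?_
  rw [Complex.zero_le_real]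
  norm_num

lemma aux_trace {N : ℕ} (A G : Matrix (Fin N) (Fin N) ℂ) (h : G * A = -(A * G))
    (e : ℂ) (he : e ≠ 0) (hG : G * G = e • 1) : A.trace = 0 := by
  have h1 : (G * A * G).trace = (A * (G * G)).trace := by
    rw [Matrix.trace_mul_cycle, Matrix.trace_mul_comm]
  rw [h, neg_mul, mul_assoc, hG, trace_neg] at h1
  simp only [mul_smul_comm, mul_one, trace_smul, smul_eq_mul] at h1
  have h2 : e * A.trace = 0 := by linear_combination (-1 / 2 : ℂ) * h1
  exact (mul_eq_zero.mp h2).resolve_left he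

lemma aux_main {N : ℕ} (hN : 1 ≤ N) (g k : Matrix (Fin N) (Fin N) ℂ) (hg : gᴴ = g)
    (hk : kᴴ = k) (hg2 : g * g = 1) (hk2 : k * k = 1) (hc : k * g = g * k)
    (tg : g.trace = 0) (tk : k.trace = 0) (tgk : (g * k).trace = 0) (E q j : ℝ) (hj : 0 ≤ j) :
    ((E : ℂ) • (1 : Matrix (Fin N) (Fin N) ℂ) + (j : ℂ) • k - (q : ℂ) • g).PosSemidef ↔
      |q| + j ≤ E := by
  obtain ⟨s, hs, hsq, hq⟩ : ∃ s : ℝ, s * s = 1 ∧ q = s * |q| ∧ |q| = s * q := by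
    rcases le_total 0 q with h | h
    · exact ⟨1, by norm_num, by rw [abs_of_nonneg h]; ring, by rw [abs_of_nonneg h]; ring⟩
    · exact ⟨-1, by norm_num, by rw [abs_of_nonpos h]; ring, by rw [abs_of_nonpos h]; ring⟩
  have hsC : (s : ℂ) * s = 1 := by exact_mod_cast hs
  have hqC : ((|q| : ℝ) : ℂ) = s * q := by exact_mod_cast hq
  have hsqC : (q : ℂ) = s * (|q| : ℝ) := by exact_mod_cast hsq
  constructor
  · intro h
    set P : Matrix (Fin N) (Fin N) ℂ := (1 + (s : ℂ) • g) * (1 - k) with hP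
    have hPH : Pᴴ = P := by
      rw [hP]
      simp only [conjTranspose_mul, conjTranspose_add, conjTranspose_sub, conjTranspose_smul,
        conjTranspose_one, hg, hk, mul_add, add_mul, sub_mul, mul_sub, mul_smul_comm,
        smul_mul_assoc, one_mul, mul_one, hc, Complex.star_def, Complex.conj_ofReal]
    have hgP : g * P = (s : ℂ) • P := by
      have : g * (1 + (s : ℂ) • g) = (s : ℂ) • (1 + (s : ℂ) • g) := by
        rw [mul_add, mul_smul_comm, hg2, smul_add, smul_smul, hsC, mul_one, one_smul, add_comm]
      rw [hP, ← mul_assoc, this, smul_mul_assoc]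
    have hcm : k * (1 + (s : ℂ) • g) = (1 + (s : ℂ) • g) * k := by
      rw [mul_add, add_mul, mul_smul_comm, smul_mul_assoc, hc, one_mul, mul_one]
    have hkP : k * P = - P := by
      rw [hP, ← mul_assoc, hcm, mul_assoc, mul_sub, hk2, ← mul_neg, mul_one, neg_sub]
    have hPP : P * P = (4 : ℂ) • P := by
      have e1 : P * P = (1 + (s : ℂ) • g) * ((1 - k) * P) := by
        conv_lhs => rw [hP]
        rw [← hP, mul_assoc]
      rw [e1, sub_mul, hkP, one_mul, sub_neg_eq_add, mul_add, add_mul, smul_mul_assoc, hgP,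
        smul_smul, hsC]
      simp only [one_mul]
      module
    have htr : P.trace = (N : ℂ) := by
      rw [hP]
      simp only [add_mul, mul_sub, one_mul, mul_one, smul_mul_assoc, trace_add, trace_sub,
        trace_smul, tg, tk, tgk, trace_one, Fintype.card_fin]
      simp
    have h1 := (h.conjTranspose_mul_mul_same P).trace_nonneg
    have h2 : ((E : ℂ) • (1 : Matrix (Fin N) (Fin N) ℂ) + (j : ℂ) • k - (q : ℂ) • g) * P
        = ((E - |q| - j : ℝ) : ℂ) • P := by
      rw [sub_mul, add_mul, smul_mul_assoc, smul_mul_assoc, smul_mul_assoc, hkP, hgP, one_mul]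
      push_cast
      rw [hqC]
      module
    rw [mul_assoc, h2, hPH, mul_smul_comm, hPP, trace_smul, trace_smul, htr] at h1
    have h3 : (0 : ℂ) ≤ (((E - |q| - j) * (4 * N) : ℝ) : ℂ) := by
      convert h1 using 1
      simp
    rw [Complex.zero_le_real] at h3
    have hN' : (0 : ℝ) < 4 * N := by positivity
    have := nonneg_of_mul_nonneg_left h3 hN'
    linarith
  · intro h
    have h1 := aux_one_add k hk hk2
    have h2 := aux_one_add (-(s : ℂ) • g) (by simp [hg]) (by
      rw [smul_mul_assoc, mul_smul_comm, hg2, smul_smul, neg_mul_neg, hsC, one_smul])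
    have h0 : (1 : Matrix (Fin N) (Fin N) ℂ).PosSemidef := PosSemidef.one
    have e : ((E : ℂ) • (1 : Matrix (Fin N) (Fin N) ℂ) + (j : ℂ) • k - (q : ℂ) • g)
        = ((E - |q| - j : ℝ) : ℂ) • (1 : Matrix (Fin N) (Fin N) ℂ) + (j : ℂ) • (1 + k)
          + ((|q| : ℝ) : ℂ) • (1 + -(s : ℂ) • g) := by
      rw [hsqC]
      push_cast
      module
    rw [e]
    refine ((h0.smul ?_).add (h1.smul ?_)).add (h2.smul ?_)
    · rw [Complex.zero_le_real]; linarith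
    · rwa [Complex.zero_le_real]
    · rw [Complex.zero_le_real]; positivity

/-- Here the antisymmetric matrix `J` is indexed by `Fin 3 = {0,1,2}`, corresponding to the
spatial indices `{1,2,3}` of the paper (so `J 0 1` is the paper's `J₁₂`, etc.). -/
theorem stmt2 (N : ℕ) (hN : 1 ≤ N) (γ : Fin 4 → Matrix (Fin N) (Fin N) ℂ)
    (hγ : IsGammaRep4 γ) (E q : ℝ) (J : Fin 3 → Fin 3 → ℝ)
    (hJ : ∀ i j, J i j = -J j i) :
    ((E : ℂ) • (1 : Matrix (Fin N) (Fin N) ℂ) +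
        Complex.I • ((J 0 1 : ℂ) • (γ 0 * γ 1 * γ 2) + (J 0 2 : ℂ) • (γ 0 * γ 1 * γ 3) +
          (J 1 2 : ℂ) • (γ 0 * γ 2 * γ 3)) - (q : ℂ) • γ 0).PosSemidef ↔
      |q| + Real.sqrt ((J 0 1) ^ 2 + (J 0 2) ^ 2 + (J 1 2) ^ 2) ≤ E := by
  obtain ⟨hcl, h0, hI⟩ := hγ
  obtain ⟨j, a, b, c, hj, hn, ha, hb, hc, hjs⟩ : ∃ j a b c : ℝ, 0 ≤ j ∧ a * a + b * b + c * c = 1 ∧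
      J 0 1 = j * a ∧ J 0 2 = j * b ∧ J 1 2 = j * c ∧
      Real.sqrt ((J 0 1) ^ 2 + (J 0 2) ^ 2 + (J 1 2) ^ 2) = j := by
    set x := J 0 1
    set y := J 0 2
    set z := J 1 2
    have hnn : 0 ≤ x ^ 2 + y ^ 2 + z ^ 2 := by positivity
    have hsq := Real.mul_self_sqrt hnn
    by_cases hz : Real.sqrt (x ^ 2 + y ^ 2 + z ^ 2) = 0
    · rw [hz] at hsq
      refine ⟨0, 1, 0, 0, le_rfl, by norm_num, ?_, ?_, ?_, hz⟩ <;>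
        nlinarith [sq_nonneg x, sq_nonneg y, sq_nonneg z]
    · set r := Real.sqrt (x ^ 2 + y ^ 2 + z ^ 2)
      refine ⟨r, x / r, y / r, z / r, Real.sqrt_nonneg _, ?_, ?_, ?_, ?_, rfl⟩ <;> field_simp
      linarith
  rw [hjs, ha, hb, hc]
  have hnC : (a : ℂ) * a + b * b + c * c = 1 := by exact_mod_cast hn
  have H1 := hI 1 (by decide)
  have H2 := hI 2 (by decide)
  have H3 := hI 3 (by decide)
  have s0 : γ 0 * γ 0 = 1 := by
    have := hcl 0 0
    simp only [if_true] at this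
    rw [← two_smul ℂ] at this
    have h := congrArg (fun X => (1 / 2 : ℂ) • X) this
    simpa [smul_smul] using h
  have sI : ∀ i : Fin 4, i ≠ 0 → γ i * γ i = -1 := by
    intro i hi
    have := hcl i i
    simp only [if_true, if_neg hi] at this
    rw [← two_smul ℂ] at this
    have h := congrArg (fun X => (1 / 2 : ℂ) • X) this
    simpa [smul_smul] using h
  have ac : ∀ i k : Fin 4, i ≠ k → γ i * γ k = -(γ k * γ i) := by
    intro i k hik
    have := hcl i k
    rw [if_neg hik] at this
    exact eq_neg_of_add_eq_zero_left this
  have s1 := sI 1 (by decide)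
  have s2 := sI 2 (by decide)
  have s3 := sI 3 (by decide)
  have c10 := ac 1 0 (by decide)
  have c20 := ac 2 0 (by decide)
  have c30 := ac 3 0 (by decide)
  have c21 := ac 2 1 (by decide)
  have c31 := ac 3 1 (by decide)
  have c32 := ac 3 2 (by decide)
  clear hI hcl sI ac
  generalize γ 0 = g0 at *
  generalize γ 1 = g1 at *
  generalize γ 2 = g2 at *
  generalize γ 3 = g3 at *
  have L : ∀ {A B C : Matrix (Fin N) (Fin N) ℂ}, A * B = -C → ∀ X, A * (B * X) = -(C * X) := by
    intro A B C h X
    rw [← mul_assoc, h, neg_mul]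
  have t0 : ∀ X, g0 * (g0 * X) = X := by
    intro X
    rw [← mul_assoc, s0, one_mul]
  have t1 := L s1
  have t2 := L s2
  have t3 := L s3
  have d10 := L c10
  have d20 := L c20
  have d30 := L c30
  have d21 := L c21
  have d31 := L c31
  have d32 := L c32
  simp only [mul_assoc] at d10 d20 d30 d21 d31 d32
  have tr1 : (g0 * g1 * g2).trace = 0 := aux_trace _ g3 (by
    simp only [mul_assoc, mul_neg, neg_neg, c30, c31, c32, d30, d31, d32]) (-1) (by norm_num)
    (by rw [s3]; simp)
  have tr2 : (g0 * g1 * g3).trace = 0 := aux_trace _ g2 (by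
    simp only [mul_assoc, mul_neg, neg_neg, c20, c21, c32, d20, d21, d32]) (-1) (by norm_num)
    (by rw [s2]; simp)
  have tr3 : (g0 * g2 * g3).trace = 0 := aux_trace _ g1 (by
    simp only [mul_assoc, mul_neg, neg_neg, c10, c21, c31, d10, d21, d31]) (-1) (by norm_num)
    (by rw [s1]; simp)
  have tr0 : g0.trace = 0 := aux_trace _ g1 c10 (-1) (by norm_num) (by rw [s1]; simp)
  have u1 : (g1 * g2).trace = 0 := aux_trace _ g1 (by
    simp only [mul_assoc, mul_neg, neg_neg, c21]) (-1) (by norm_num) (by rw [s1]; simp)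
  have u2 : (g1 * g3).trace = 0 := aux_trace _ g1 (by
    simp only [mul_assoc, mul_neg, neg_neg, c31]) (-1) (by norm_num) (by rw [s1]; simp)
  have u3 : (g2 * g3).trace = 0 := aux_trace _ g2 (by
    simp only [mul_assoc, mul_neg, neg_neg, c32]) (-1) (by norm_num) (by rw [s2]; simp)
  have key := aux_main hN g0 (Complex.I • ((a : ℂ) • (g0 * g1 * g2) + (b : ℂ) • (g0 * g1 * g3) +
          (c : ℂ) • (g0 * g2 * g3))) h0 (by
      simp only [conjTranspose_smul, conjTranspose_add, conjTranspose_mul, h0, H1, H2, H3,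
        mul_assoc, mul_neg, neg_mul, neg_neg, c10, c20, c30, c21, c31, c32, d10, d20, d30, d21,
        d31, d32, Complex.star_def, Complex.conj_ofReal, Complex.conj_I]
      module) s0 (by
      have hI2 : Complex.I * Complex.I = -1 := Complex.I_mul_I
      simp only [smul_mul_assoc, mul_smul_comm, smul_smul, hI2, mul_add, add_mul, smul_add,
        mul_assoc, mul_neg, neg_mul, neg_neg, c10, c20, c30, c21, c31, c32, d10, d20, d30, d21,
        d31, d32, s0, s1, s2, s3, t0, t1, t2, t3, mul_one]
      have : (1 : Matrix (Fin N) (Fin N) ℂ) = ((a : ℂ) * a + b * b + c * c) • 1 := by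
        rw [hnC, one_smul]
      conv_rhs => rw [this]
      match_scalars <;> first | ring1 | linear_combination (-((a : ℂ) ^ 2 + b ^ 2 + c ^ 2)) * hI2) (by
      simp only [smul_mul_assoc, mul_smul_comm, mul_add, add_mul, smul_add,
        mul_assoc, mul_neg, neg_mul, neg_neg, c10, c20, c30, c21, c31, c32, d10, d20, d30, d21,
        d31, d32, s0, t0, mul_one]) tr0 (by
      simp only [trace_smul, trace_add, tr1, tr2, tr3, smul_zero, add_zero]) (by
      simp only [mul_smul_comm, mul_add, mul_assoc, t0, trace_smul, trace_add, u1, u2, u3,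
        smul_zero, add_zero]) E q j hj
  rw [← key]
  have e : ∀ A B C : Matrix (Fin N) (Fin N) ℂ,
      Complex.I • (((j * a : ℝ) : ℂ) • A + ((j * b : ℝ) : ℂ) • B + ((j * c : ℝ) : ℂ) • C) =
      (j : ℂ) • (Complex.I • ((a : ℂ) • A + (b : ℂ) • B + (c : ℂ) • C)) := by
    intro A B C
    push_cast
    module
  rw [e]
end

section
/- Let γ⁰, γ¹, γ², γ³ be a 4D gamma representation on ℂ^N and set γ⁴ := γ⁰γ¹γ²γ³. For all real numbers E, J₁, J₂, q, the Hermitian matrix E·1 + i J₁ γ⁰γ¹γ² + i J₂ γ⁰γ³γ⁴ − (√3/2) q·γ⁰ is positive semidefinite if and only if E − (√3/2)q ≥ |J₁ + J₂| and E + (√3/2)q ≥ |J₁ − J₂|. -/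
open Matrix
open scoped ComplexOrder

section aux
variable {N : ℕ}

lemma aux_trace_zero (X Y : Matrix (Fin N) (Fin N) ℂ) (hX : X * X = -1) (h : X * Y = -(Y * X)) :
    Y.trace = 0 := by
  have h1 : (X * Y * X).trace = - Y.trace := by
    rw [Matrix.trace_mul_comm, ← mul_assoc, hX, neg_one_mul, Matrix.trace_neg]
  have h2 : (X * Y * X).trace = Y.trace := by
    rw [h, neg_mul, mul_assoc, hX, mul_neg_one, neg_neg]
  have h3 := h1.symm.trans h2
  linear_combination (-1 / 2 : ℂ) * h3

/-- A commuting pair of Hermitian involutions. -/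
structure AuxPair (G B : Matrix (Fin N) (Fin N) ℂ) : Prop where
  gg : G * G = 1
  bb : B * B = 1
  comm : B * G = G * B
  hg : Gᴴ = G
  hb : Bᴴ = B

/-- Four times the joint spectral projection. -/
def auxP (G B : Matrix (Fin N) (Fin N) ℂ) : Matrix (Fin N) (Fin N) ℂ := 1 + G + B + G * B

lemma AuxPair.negG {G B : Matrix (Fin N) (Fin N) ℂ} (h : AuxPair G B) : AuxPair (-G) B :=
  ⟨by simp [h.gg], h.bb, by simp [h.comm], by simp [h.hg], h.hb⟩

lemma AuxPair.negB {G B : Matrix (Fin N) (Fin N) ℂ} (h : AuxPair G B) : AuxPair G (-B) :=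
  ⟨h.gg, by simp [h.bb], by simp [h.comm], h.hg, by simp [h.hb]⟩

lemma AuxPair.PG {G B : Matrix (Fin N) (Fin N) ℂ} (h : AuxPair G B) :
    auxP G B * G = auxP G B := by
  have : G * B * G = B := by rw [mul_assoc, h.comm, ← mul_assoc, h.gg, one_mul]
  simp only [auxP, add_mul, one_mul, h.gg, h.comm, this]
  abel

lemma AuxPair.PB {G B : Matrix (Fin N) (Fin N) ℂ} (h : AuxPair G B) :
    auxP G B * B = auxP G B := by
  have : G * B * B = G := by rw [mul_assoc, h.bb, mul_one]
  simp only [auxP, add_mul, one_mul, h.bb, this]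
  abel

lemma AuxPair.PH {G B : Matrix (Fin N) (Fin N) ℂ} (h : AuxPair G B) :
    (auxP G B)ᴴ = auxP G B := by
  simp [auxP, Matrix.conjTranspose_mul, h.hg, h.hb, h.comm]

lemma AuxPair.PP {G B : Matrix (Fin N) (Fin N) ℂ} (h : AuxPair G B) :
    auxP G B * auxP G B = (4 : ℂ) • auxP G B := by
  conv_lhs => arg 2; rw [auxP]
  simp only [mul_add, mul_one, ← mul_assoc, h.PG, h.PB]
  module

lemma AuxPair.psd {G B : Matrix (Fin N) (Fin N) ℂ} (h : AuxPair G B) (r : ℝ) (hr : 0 ≤ r) :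
    ((r : ℂ) • auxP G B).PosSemidef := by
  have h1 := Matrix.posSemidef_conjTranspose_mul_self (auxP G B)
  rw [h.PH, h.PP] at h1
  have h2 : (0 : ℂ) ≤ ((r / 4 : ℝ) : ℂ) := by
    exact_mod_cast (by positivity : (0:ℝ) ≤ r / 4)
  have h3 := h1.smul h2
  convert h3 using 1
  rw [smul_smul]
  congr 1
  push_cast
  ring

lemma AuxPair.nec {G B : Matrix (Fin N) (Fin N) ℂ} (hN : 1 ≤ N) (h : AuxPair G B)
    (tG : G.trace = 0) (tB : B.trace = 0) (tGB : (G * B).trace = 0) (E a b k : ℝ)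
    (hM : ((E : ℂ) • (1 : Matrix (Fin N) (Fin N) ℂ) + (a : ℂ) • (G * B) + (b : ℂ) • B
      - (k : ℂ) • G).PosSemidef) : 0 ≤ E + a + b - k := by
  have h1 := (hM.conjTranspose_mul_mul_same (auxP G B)).trace_nonneg
  have e : auxP G B * ((E : ℂ) • (1 : Matrix (Fin N) (Fin N) ℂ) + (a : ℂ) • (G * B) + (b : ℂ) • B
      - (k : ℂ) • G) = ((E + a + b - k : ℝ) : ℂ) • auxP G B := by
    simp only [mul_add, mul_sub, mul_smul_comm, mul_one, ← mul_assoc, h.PG, h.PB]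
    push_cast
    module
  rw [h.PH, e, smul_mul_assoc, h.PP] at h1
  have t : (auxP G B).trace = N := by simp [auxP, tG, tB, tGB]
  rw [Matrix.trace_smul, Matrix.trace_smul, t] at h1
  have h2 : 0 ≤ (E + a + b - k) * (4 * N) := by
    simp only [smul_eq_mul] at h1
    exact_mod_cast h1
  have hN' : (0 : ℝ) < 4 * N := by
    have : (1 : ℝ) ≤ N := by exact_mod_cast hN
    linarith
  exact nonneg_of_mul_nonneg_left h2 hN'

lemma AuxPair.main {G B : Matrix (Fin N) (Fin N) ℂ} (hN : 1 ≤ N) (h : AuxPair G B)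
    (tG : G.trace = 0) (tB : B.trace = 0) (tGB : (G * B).trace = 0) (E a b k : ℝ) :
    ((E : ℂ) • (1 : Matrix (Fin N) (Fin N) ℂ) + (a : ℂ) • (G * B) + (b : ℂ) • B
      - (k : ℂ) • G).PosSemidef ↔ (|a + b| ≤ E - k ∧ |a - b| ≤ E + k) := by
  constructor
  · intro hM
    have h1 := h.nec hN tG tB tGB E a b k hM
    have h2 := h.negB.nec hN tG (by simp [tB]) (by simp [tGB]) E (-a) (-b) k
      (by convert hM using 1; simp)
    have h3 := h.negG.nec hN (by simp [tG]) tB (by simp [tGB]) E (-a) b (-k)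
      (by convert hM using 1; simp)
    have h4 := h.negG.negB.nec hN (by simp [tG]) (by simp [tB]) (by simp [tGB]) E a (-b) (-k)
      (by convert hM using 1; simp)
    constructor <;> rw [abs_le] <;> constructor <;> linarith
  · rintro ⟨h1, h2⟩
    rw [abs_le] at h1 h2
    have p1 := h.psd ((E + a + b - k) / 4) (by linarith)
    have p2 := h.negB.psd ((E - a - b - k) / 4) (by linarith)
    have p3 := h.negG.psd ((E - a + b + k) / 4) (by linarith)
    have p4 := h.negG.negB.psd ((E + a - b + k) / 4) (by linarith)
    convert ((p1.add p2).add p3).add p4 using 1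
    simp only [auxP, neg_mul, mul_neg, neg_neg]
    push_cast
    module

end aux

theorem stmt3 (N : ℕ) (hN : 1 ≤ N) (γ : Fin 4 → Matrix (Fin N) (Fin N) ℂ)
    (hγ : IsGammaRep4 γ) (γ4 : Matrix (Fin N) (Fin N) ℂ) (hγ4 : γ4 = γ 0 * γ 1 * γ 2 * γ 3)
    (E J₁ J₂ q : ℝ) :
    ((E : ℂ) • (1 : Matrix (Fin N) (Fin N) ℂ) +
        (Complex.I * (J₁ : ℂ)) • (γ 0 * γ 1 * γ 2) +
        (Complex.I * (J₂ : ℂ)) • (γ 0 * γ 3 * γ4) -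
        ((Real.sqrt 3 / 2 * q : ℝ) : ℂ) • γ 0).PosSemidef ↔
      (|J₁ + J₂| ≤ E - Real.sqrt 3 / 2 * q ∧ |J₁ - J₂| ≤ E + Real.sqrt 3 / 2 * q) := by
  obtain ⟨hc, h0, hh⟩ := hγ
  have sq (a : Fin 4) (ha : a ≠ 0) : γ a * γ a = -1 := by
    have := hc a a
    simp only [if_true, if_neg ha, mul_one] at this
    have h2 : (2 : ℂ) • (γ a * γ a) = (2 : ℂ) • (-1) := by
      rw [two_smul, this]; module
    exact smul_right_injective _ (two_ne_zero' ℂ) h2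
  have sq0 : γ 0 * γ 0 = 1 := by
    have := hc 0 0
    simp only [if_true] at this
    have h2 : (2 : ℂ) • (γ 0 * γ 0) = (2 : ℂ) • 1 := by
      rw [two_smul, this]; module
    exact smul_right_injective _ (two_ne_zero' ℂ) h2
  have ac (a b : Fin 4) (hab : a ≠ b) : γ a * γ b = -(γ b * γ a) := by
    have := hc a b
    rw [if_neg hab] at this
    exact eq_neg_of_add_eq_zero_left this
  have s1 := sq 1 (by decide)
  have s2 := sq 2 (by decide)
  have s3 := sq 3 (by decide)
  have a10 := ac 1 0 (by decide)
  have a20 := ac 2 0 (by decide)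
  have a30 := ac 3 0 (by decide)
  have a21 := ac 2 1 (by decide)
  have a31 := ac 3 1 (by decide)
  have a32 := ac 3 2 (by decide)
  have c1 := hh 1 (by decide)
  have c2 := hh 2 (by decide)
  generalize γ 0 = g0 at *
  generalize γ 1 = g1 at *
  generalize γ 2 = g2 at *
  generalize γ 3 = g3 at *
  have k10 (x) : g1 * (g0 * x) = -(g0 * (g1 * x)) := by rw [← mul_assoc, a10]; simp [mul_assoc]
  have k20 (x) : g2 * (g0 * x) = -(g0 * (g2 * x)) := by rw [← mul_assoc, a20]; simp [mul_assoc]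
  have k30 (x) : g3 * (g0 * x) = -(g0 * (g3 * x)) := by rw [← mul_assoc, a30]; simp [mul_assoc]
  have k21 (x) : g2 * (g1 * x) = -(g1 * (g2 * x)) := by rw [← mul_assoc, a21]; simp [mul_assoc]
  have k31 (x) : g3 * (g1 * x) = -(g1 * (g3 * x)) := by rw [← mul_assoc, a31]; simp [mul_assoc]
  have k32 (x) : g3 * (g2 * x) = -(g2 * (g3 * x)) := by rw [← mul_assoc, a32]; simp [mul_assoc]
  have k00 (x) : g0 * (g0 * x) = x := by rw [← mul_assoc, sq0, one_mul]
  have k11 (x) : g1 * (g1 * x) = -x := by rw [← mul_assoc, s1]; simp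
  have k22 (x) : g2 * (g2 * x) = -x := by rw [← mul_assoc, s2]; simp
  have hp : AuxPair g0 (Complex.I • (g1 * g2)) := by
    refine ⟨sq0, ?_, ?_, h0, ?_⟩
    · simp [smul_smul, mul_assoc, k21, s1, s2]
    · simp [mul_assoc, k10, a20]
    · simp [Matrix.conjTranspose_smul, Matrix.conjTranspose_mul, c1, c2, a21]
  have tG : g0.trace = 0 := aux_trace_zero g1 g0 s1 a10
  have tB : (Complex.I • (g1 * g2)).trace = 0 := aux_trace_zero g1 _ s1 (by
    simp [mul_assoc, k11, a21])
  have tGB : (g0 * Complex.I • (g1 * g2)).trace = 0 := aux_trace_zero g3 _ s3 (by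
    simp [mul_assoc, k30, k31, a32])
  rw [← hp.main hN tG tB tGB]
  have e : g0 * g3 * γ4 = g1 * g2 := by
    rw [hγ4]
    simp [mul_assoc, k00, k30, k31, k32, s3]
  rw [e, mul_smul_comm, smul_smul, smul_smul, mul_comm Complex.I, mul_comm Complex.I, mul_assoc g0]
end

section
/- Let γ⁰, γ¹, γ², γ³ be a 4D gamma representation on ℂ^N. For all real numbers E, q, P₁, P₂, P₃, the Hermitian matrix E·1 − i(P₁γ¹ + P₂γ² + P₃γ³) − q·γ⁰ is positive semidefinite if and only if E ≥ √(P₁² + P₂² + P₃² + q²). -/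
open Matrix
open scoped ComplexOrder

lemma core_aux {N : ℕ} (hN : 1 ≤ N) (A : Matrix (Fin N) (Fin N) ℂ) (hA : Aᴴ = A) (r E : ℝ)
    (hr : 0 ≤ r) (hA2 : A * A = ((r : ℂ) * r) • (1 : Matrix (Fin N) (Fin N) ℂ))
    (htr : A.trace = 0) :
    ((E : ℂ) • (1 : Matrix (Fin N) (Fin N) ℂ) - A).PosSemidef ↔ r ≤ E := by
  have hNr : (0 : ℝ) < N := by exact_mod_cast hN
  have hherm : ∀ s : ℝ, ((s : ℂ) • (1 : Matrix (Fin N) (Fin N) ℂ) + A)ᴴ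
      = (s : ℂ) • (1 : Matrix (Fin N) (Fin N) ℂ) + A := by
    intro s
    simp [conjTranspose_add, conjTranspose_smul, hA]
  have hherm' : ∀ s : ℝ, ((s : ℂ) • (1 : Matrix (Fin N) (Fin N) ℂ) - A)ᴴ
      = (s : ℂ) • (1 : Matrix (Fin N) (Fin N) ℂ) - A := by
    intro s
    simp [conjTranspose_sub, conjTranspose_smul, hA]
  constructor
  · intro h
    rcases hr.eq_or_lt with h0 | hpos
    · have ht := h.trace_nonneg
      rw [trace_sub, htr, trace_smul, trace_one, sub_zero, smul_eq_mul, Fintype.card_fin] at ht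
      have ht' : (0 : ℝ) ≤ E * N := by exact_mod_cast ht
      rw [← h0]
      exact nonneg_of_mul_nonneg_left ht' hNr
    · have h2 := h.conjTranspose_mul_mul_same ((r : ℂ) • (1 : Matrix (Fin N) (Fin N) ℂ) + A)
      rw [hherm] at h2
      have e : ((r : ℂ) • (1 : Matrix (Fin N) (Fin N) ℂ) + A) *
          ((E : ℂ) • (1 : Matrix (Fin N) (Fin N) ℂ) - A) *
          ((r : ℂ) • (1 : Matrix (Fin N) (Fin N) ℂ) + A)
          = (((E : ℂ) - r) * (2 * r)) • ((r : ℂ) • (1 : Matrix (Fin N) (Fin N) ℂ) + A) := by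
        simp only [add_mul, mul_add, sub_mul, mul_sub, smul_mul_assoc, mul_smul_comm, one_mul,
          mul_one, hA2]
        module
      rw [e] at h2
      have ht := h2.trace_nonneg
      rw [trace_smul, trace_add, htr, trace_smul, trace_one, add_zero, smul_eq_mul, smul_eq_mul,
        Fintype.card_fin] at ht
      have ht' : (0 : ℝ) ≤ (E - r) * (2 * r) * (r * N) := by exact_mod_cast ht
      have hp : 0 < (2 * r) * (r * N) := by positivity
      rw [mul_assoc] at ht'
      linarith [nonneg_of_mul_nonneg_left ht' hp]
  · intro h
    have h1 : ((r : ℂ) • (1 : Matrix (Fin N) (Fin N) ℂ) - A).PosSemidef := by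
      rcases hr.eq_or_lt with h0 | hpos
      · subst h0
        have : A = 0 := by
          apply conjTranspose_mul_self_eq_zero.mp
          rw [hA, hA2]; simp
        subst this
        simpa using PosSemidef.zero
      · have h2 := posSemidef_conjTranspose_mul_self
          ((r : ℂ) • (1 : Matrix (Fin N) (Fin N) ℂ) - A)
        rw [hherm'] at h2
        have hc : (0 : ℂ) ≤ ((1 / (2 * r) : ℝ) : ℂ) := by
          exact_mod_cast (by positivity : (0 : ℝ) ≤ 1 / (2 * r))
        have h3 := h2.smul hc
        convert h3 using 1
        have e : ((r : ℂ) • (1 : Matrix (Fin N) (Fin N) ℂ) - A) *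
          ((r : ℂ) • (1 : Matrix (Fin N) (Fin N) ℂ) - A)
          = (2 * r : ℂ) • ((r : ℂ) • (1 : Matrix (Fin N) (Fin N) ℂ) - A) := by
          simp only [sub_mul, mul_sub, smul_mul_assoc, mul_smul_comm, one_mul, mul_one, hA2]
          module
        have hrc : (r : ℂ) ≠ 0 := by exact_mod_cast hpos.ne'
        rw [e, smul_smul]
        have : ((1 / (2 * r) : ℝ) : ℂ) * (2 * r) = 1 := by
          push_cast; field_simp
        rw [this, one_smul]
    have hc : (0 : ℂ) ≤ ((E - r : ℝ) : ℂ) := by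
      exact_mod_cast sub_nonneg.mpr h
    have h2 := ((PosSemidef.one (n := Fin N) (R := ℂ)).smul hc).add h1
    convert h2 using 1
    push_cast
    module

theorem stmt4 (N : ℕ) (hN : 1 ≤ N) (γ : Fin 4 → Matrix (Fin N) (Fin N) ℂ)
    (hγ : IsGammaRep4 γ) (E q P₁ P₂ P₃ : ℝ) :
    ((E : ℂ) • (1 : Matrix (Fin N) (Fin N) ℂ) -
        Complex.I • ((P₁ : ℂ) • γ 1 + (P₂ : ℂ) • γ 2 + (P₃ : ℂ) • γ 3) -
        (q : ℂ) • γ 0).PosSemidef ↔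
      Real.sqrt (P₁ ^ 2 + P₂ ^ 2 + P₃ ^ 2 + q ^ 2) ≤ E := by
  obtain ⟨hC, h0, hI⟩ := hγ
  have half : ∀ (X : Matrix (Fin N) (Fin N) ℂ) (c : ℂ), X + X = (2 * c) • 1 → X = c • 1 := by
    intro X c h
    have : (2 : ℂ) • X = (2 : ℂ) • (c • (1 : Matrix (Fin N) (Fin N) ℂ)) := by
      rw [two_smul, h, smul_smul]
    exact smul_right_injective _ (two_ne_zero) this
  have s0 : γ 0 * γ 0 = (1 : ℂ) • 1 := half _ _ (by rw [hC]; simp)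
  have s1 : γ 1 * γ 1 = (-1 : ℂ) • 1 := half _ _ (by rw [hC]; simp)
  have s2 : γ 2 * γ 2 = (-1 : ℂ) • 1 := half _ _ (by rw [hC]; simp)
  have s3 : γ 3 * γ 3 = (-1 : ℂ) • 1 := half _ _ (by rw [hC]; simp)
  have anti : ∀ a b, a ≠ b → γ a * γ b = - (γ b * γ a) := by
    intro a b h
    have := hC a b
    rw [if_neg h] at this
    exact eq_neg_of_add_eq_zero_left this
  have tr0 : ∀ a b (c : ℂ), a ≠ b → c ≠ 0 → γ b * γ b = c • 1 → (γ a).trace = 0 := by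
    intro a b c hab hc hb
    have e1 : (γ a * γ b * γ b).trace = c * (γ a).trace := by
      rw [mul_assoc, hb]; simp
    have e2 : (γ a * γ b * γ b).trace = - (c * (γ a).trace) := by
      rw [anti a b hab, neg_mul, trace_neg, trace_mul_comm, ← mul_assoc, hb]; simp
    have : c * (γ a).trace = 0 := by
      rw [e1] at e2
      exact self_eq_neg.mp e2
    exact (mul_eq_zero.mp this).resolve_left hc
  have t0 := tr0 0 1 (-1) (by decide) (by norm_num) s1
  have t1 := tr0 1 2 (-1) (by decide) (by norm_num) s2
  have t2 := tr0 2 1 (-1) (by decide) (by norm_num) s1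
  have t3 := tr0 3 1 (-1) (by decide) (by norm_num) s1
  rw [sub_sub]
  apply core_aux hN
  · simp only [conjTranspose_add, conjTranspose_smul, h0, hI 1 (by decide), hI 2 (by decide),
      hI 3 (by decide), Complex.star_def, Complex.conj_I, Complex.conj_ofReal]
    module
  · positivity
  · rw [← Complex.ofReal_mul, Real.mul_self_sqrt (by positivity)]
    simp only [add_mul, mul_add, smul_mul_assoc, mul_smul_comm, smul_add, smul_smul, s0, s1, s2,
      s3, anti 1 0 (by decide), anti 2 0 (by decide), anti 3 0 (by decide),
      anti 2 1 (by decide), anti 3 1 (by decide), anti 3 2 (by decide)]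
    push_cast
    match_scalars <;> ring_nf <;> simp only [Complex.I_sq] <;> ring
  · simp [trace_add, trace_smul, t0, t1, t2, t3]
end

section
/- Let γ⁰, γ¹, γ², γ³ be a 4D gamma representation on ℂ^N. Let E_I, A_I (I = 1,2,3) be real numbers and F_{IJ} (I,J ∈ {1,2,3}) be real and antisymmetric, and define 𝒜_I := ½ Σ_J E_J γ⁰γ^Jγ^I − ¼ Σ_{J,K} F_{JK} γ^{JK}γ^I + i A_I·1, where γ^{JK} := ½(γ^Jγ^K − γ^Kγ^J) and all sums run over {1,2,3}. Then Σ_{I,J} 𝒜_I† γ^{IJ} 𝒜_J = (½ Σ_I E_I² + ¼ Σ_{I,J} F_{IJ}²)·1 + Σ_{I,J} E_I F_{IJ} γ⁰γ^J. -/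
open Matrix

/-- The antisymmetrized product `γ^{IJ} = ½(γ^I γ^J − γ^J γ^I)` of spatial gammas, with
spatial indices `I, J : Fin 3` corresponding to `γ 1, γ 2, γ 3`. -/
noncomputable def gamma2 {N : ℕ} (γ : Fin 4 → Matrix (Fin N) (Fin N) ℂ) (I J : Fin 3) :
    Matrix (Fin N) (Fin N) ℂ :=
  (1 / 2 : ℂ) • (γ I.succ * γ J.succ - γ J.succ * γ I.succ)

/-- The spatial components `𝒜_I = ½ Σ_J E_J γ⁰γ^Jγ^I − ¼ Σ_{J,K} F_{JK} γ^{JK}γ^I + i A_I·1`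
of the supercovariant connection of 4D minimal gauged supergravity. -/
noncomputable def superA {N : ℕ} (γ : Fin 4 → Matrix (Fin N) (Fin N) ℂ)
    (E A : Fin 3 → ℝ) (F : Fin 3 → Fin 3 → ℝ) (I : Fin 3) : Matrix (Fin N) (Fin N) ℂ :=
  (1 / 2 : ℂ) • ∑ J, (E J : ℂ) • (γ 0 * γ J.succ * γ I.succ) -
    (1 / 4 : ℂ) • ∑ J, ∑ K, (F J K : ℂ) • (gamma2 γ J K * γ I.succ) +
    (Complex.I * (A I : ℂ)) • (1 : Matrix (Fin N) (Fin N) ℂ)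

set_option maxHeartbeats 4000000 in
theorem stmt12 (N : ℕ) (hN : 1 ≤ N) (γ : Fin 4 → Matrix (Fin N) (Fin N) ℂ)
    (hγ : IsGammaRep4 γ) (E A : Fin 3 → ℝ) (F : Fin 3 → Fin 3 → ℝ)
    (hF : ∀ I J, F I J = -F J I) :
    ∑ I, ∑ J, (superA γ E A F I)ᴴ * gamma2 γ I J * superA γ E A F J =
      ((((∑ I, (E I) ^ 2) / 2 + (∑ I, ∑ J, (F I J) ^ 2) / 4 : ℝ) : ℂ)) •
          (1 : Matrix (Fin N) (Fin N) ℂ) +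
        ∑ I, ∑ J, ((E I * F I J : ℝ) : ℂ) • (γ 0 * γ J.succ) := by
  obtain ⟨hc, h0, hs⟩ := hγ
  have hd : ∀ x : Matrix (Fin N) (Fin N) ℂ, ∀ k : ℂ, x * x + x * x = (2 * k) • 1 → x * x = k • 1 := by
    intro x k h
    have h2 : (2 : ℂ) • (x * x) = (2 : ℂ) • (k • (1 : Matrix (Fin N) (Fin N) ℂ)) := by
      rw [two_smul, h, smul_smul]
    exact smul_right_injective _ (two_ne_zero) h2
  have haa : γ 0 * γ 0 = 1 := by
    have := hd (γ 0) 1 (by simpa using hc 0 0)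
    simpa using this
  have hbb : γ 1 * γ 1 = -1 := by
    have := hd (γ 1) (-1) (by simpa using hc 1 1)
    simpa using this
  have hcc : γ 2 * γ 2 = -1 := by
    have := hd (γ 2) (-1) (by simpa using hc 2 2)
    simpa using this
  have hdd : γ 3 * γ 3 = -1 := by
    have := hd (γ 3) (-1) (by simpa using hc 3 3)
    simpa using this
  have hba : γ 1 * γ 0 = -(γ 0 * γ 1) := eq_neg_of_add_eq_zero_left (by simpa using hc 1 0)
  have hca : γ 2 * γ 0 = -(γ 0 * γ 2) := eq_neg_of_add_eq_zero_left (by simpa using hc 2 0)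
  have hda : γ 3 * γ 0 = -(γ 0 * γ 3) := eq_neg_of_add_eq_zero_left (by simpa using hc 3 0)
  have hcb : γ 2 * γ 1 = -(γ 1 * γ 2) := eq_neg_of_add_eq_zero_left (by simpa using hc 2 1)
  have hdb : γ 3 * γ 1 = -(γ 1 * γ 3) := eq_neg_of_add_eq_zero_left (by simpa using hc 3 1)
  have hdc : γ 3 * γ 2 = -(γ 2 * γ 3) := eq_neg_of_add_eq_zero_left (by simpa using hc 3 2)
  have sb : (γ 1)ᴴ = -γ 1 := hs 1 (by decide)
  have sc : (γ 2)ᴴ = -γ 2 := hs 2 (by decide)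
  have sd : (γ 3)ᴴ = -γ 3 := hs 3 (by decide)
  have e0 : (0 : Fin 3).succ = (1 : Fin 4) := rfl
  have e1 : (1 : Fin 3).succ = (2 : Fin 4) := rfl
  have e2 : (2 : Fin 3).succ = (3 : Fin 4) := rfl
  have f00 : F 0 0 = 0 := by linarith [hF 0 0]
  have f11 : F 1 1 = 0 := by linarith [hF 1 1]
  have f22 : F 2 2 = 0 := by linarith [hF 2 2]
  have f10 := hF 1 0
  have f20 := hF 2 0
  have f21 := hF 2 1
  have g00 : gamma2 γ 0 0 = 0 := by simp [gamma2]
  have g11 : gamma2 γ 1 1 = 0 := by simp [gamma2]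
  have g22 : gamma2 γ 2 2 = 0 := by simp [gamma2]
  have g01 : gamma2 γ 0 1 = γ 1 * γ 2 := by rw [gamma2, e0, e1, hcb]; module
  have g10 : gamma2 γ 1 0 = -(γ 1 * γ 2) := by rw [gamma2, e0, e1, hcb]; module
  have g02 : gamma2 γ 0 2 = γ 1 * γ 3 := by rw [gamma2, e0, e2, hdb]; module
  have g20 : gamma2 γ 2 0 = -(γ 1 * γ 3) := by rw [gamma2, e0, e2, hdb]; module
  have g12 : gamma2 γ 1 2 = γ 2 * γ 3 := by rw [gamma2, e1, e2, hdc]; module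
  have g21 : gamma2 γ 2 1 = -(γ 2 * γ 3) := by rw [gamma2, e1, e2, hdc]; module
  simp only [superA, Fin.sum_univ_three, g00, g11, g22, g01, g10, g02, g20, g12, g21, e0, e1, e2,
    f00, f11, f22, f10, f20, f21]
  clear hc hs hF hd g00 g11 g22 g01 g10 g02 g20 g12 g21 f00 f11 f22 f10 f20 f21
  generalize γ 0 = a at *
  generalize γ 1 = b at *
  generalize γ 2 = c at *
  generalize γ 3 = d at *
  generalize E 0 = E0
  generalize E 1 = E1
  generalize E 2 = E2
  generalize F 0 1 = F1
  generalize F 0 2 = F2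
  generalize F 1 2 = F3
  generalize A 0 = A0
  generalize A 1 = A1
  generalize A 2 = A2
  have L : ∀ {x y z : Matrix (Fin N) (Fin N) ℂ}, x * y = z → ∀ w, x * (y * w) = z * w := by
    intro x y z h w
    rw [← mul_assoc, h]
  have laa := L haa
  have lbb := L hbb
  have lcc := L hcc
  have ldd := L hdd
  have lba := L hba
  have lca := L hca
  have lda := L hda
  have lcb := L hcb
  have ldb := L hdb
  have ldc := L hdc
  have key : ∀ p q r : Matrix (Fin N) (Fin N) ℂ, ∀ p' q' r', p = p' → q = q' → r = r' →
    pᴴ * 0 * p + pᴴ * (b * c) * q + pᴴ * (b * d) * r +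
    (qᴴ * -(b * c) * p + qᴴ * 0 * q + qᴴ * (c * d) * r) +
    (rᴴ * -(b * d) * p + rᴴ * -(c * d) * q + rᴴ * 0 * r) =
     p'ᴴ * (b * c * q' + b * d * r') + q'ᴴ * (c * d * r' - b * c * p')
     - r'ᴴ * (b * d * p' + c * d * q') := by
    rintro p q r _ _ _ rfl rfl rfl
    noncomm_ring
  rw [key _ _ _
    ((-E0 / 2 : ℂ) • a + (-E1 / 2 : ℂ) • (a * (b * c)) + (-E2 / 2 : ℂ) • (a * (b * d))
      + (-F1 / 2 : ℂ) • c + (-F2 / 2 : ℂ) • d + (-F3 / 2 : ℂ) • (b * (c * d))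
      + (Complex.I * A0) • 1)
    ((-E1 / 2 : ℂ) • a + (E0 / 2 : ℂ) • (a * (b * c)) + (-E2 / 2 : ℂ) • (a * (c * d))
      + (F1 / 2 : ℂ) • b + (-F3 / 2 : ℂ) • d + (F2 / 2 : ℂ) • (b * (c * d))
      + (Complex.I * A1) • 1)
    ((-E2 / 2 : ℂ) • a + (E0 / 2 : ℂ) • (a * (b * d)) + (E1 / 2 : ℂ) • (a * (c * d))
      + (F2 / 2 : ℂ) • b + (F3 / 2 : ℂ) • c + (-F1 / 2 : ℂ) • (b * (c * d))
      + (Complex.I * A2) • 1) ?_ ?_ ?_]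
  · simp only [conjTranspose_add, conjTranspose_smul, conjTranspose_mul, conjTranspose_one,
      h0, sb, sc, sd, star_div₀, star_neg, star_mul', Complex.star_def, Complex.conj_ofReal,
      Complex.conj_I, map_ofNat]
    simp only [mul_add, add_mul, mul_sub, sub_mul, smul_mul_assoc, mul_smul_comm, mul_assoc,
      neg_mul, mul_neg, neg_neg, one_mul, mul_one, smul_neg, 
      haa, hbb, hcc, hdd, hba, hca, hda, hcb, hdb, hdc,
      laa, lbb, lcc, ldd, lba, lca, lda, lcb, ldb, ldc]
    match_scalars <;> push_cast <;> ring
  all_goals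
    simp only [mul_add, add_mul, mul_sub, sub_mul, smul_mul_assoc, mul_smul_comm, mul_assoc,
      neg_mul, mul_neg, neg_neg, one_mul, mul_one, smul_neg, zero_mul, mul_zero,
      haa, hbb, hcc, hdd, hba, hca, hda, hcb, hdb, hdc,
      laa, lbb, lcc, ldd, lba, lca, lda, lcb, ldb, ldc]
    match_scalars <;> push_cast <;> ring
end

section
/- Let γ⁰, γ¹, γ², γ³ be a 4D gamma representation on ℂ^N. Let E_I, A_I (I = 1,2,3) be real numbers and F_{IJ} (I,J ∈ {1,2,3}) be real and antisymmetric, and define 𝒜_I := ½ Σ_J E_J γ⁰γ^Jγ^I − ¼ Σ_{J,K} F_{JK} γ^{JK}γ^I + i A_I·1, where γ^{JK} := ½(γ^Jγ^K − γ^Kγ^J) and all sums run over {1,2,3}. Then for each I ∈ {1,2,3}: Σ_J γ^{IJ}𝒜_J = −E_I γ⁰ − ½ Σ_{J,K} F_{JK} γ^{IJK} + i Σ_J A_J γ^{IJ}, where γ^{IJK} denotes the totally antisymmetrized product of γ^I, γ^J, γ^K (equal to γ^Iγ^Jγ^K when I, J, K are pairwise distinct and to 0 when two indices coincide); in particular Σ_J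 γ^{IJ}𝒜_J is a Hermitian matrix. -/
open Matrix

/-- The totally antisymmetrized product `γ^{IJK}` of spatial gammas: equal to
`γ^I γ^J γ^K` when `I, J, K` are pairwise distinct and to `0` when two indices coincide. -/
noncomputable def gamma3 {N : ℕ} (γ : Fin 4 → Matrix (Fin N) (Fin N) ℂ) (I J K : Fin 3) :
    Matrix (Fin N) (Fin N) ℂ :=
  if I ≠ J ∧ I ≠ K ∧ J ≠ K then γ I.succ * γ J.succ * γ K.succ else 0

theorem stmt13 (N : ℕ) (hN : 1 ≤ N) (γ : Fin 4 → Matrix (Fin N) (Fin N) ℂ)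
    (hγ : IsGammaRep4 γ) (E A : Fin 3 → ℝ) (F : Fin 3 → Fin 3 → ℝ)
    (hF : ∀ I J, F I J = -F J I) :
    ∀ I : Fin 3,
      (∑ J, gamma2 γ I J * superA γ E A F J =
        -((E I : ℂ)) • γ 0 - ∑ J, ∑ K, ((F J K / 2 : ℝ) : ℂ) • gamma3 γ I J K +
          ∑ J, (Complex.I * (A J : ℂ)) • gamma2 γ I J) ∧
      (∑ J, gamma2 γ I J * superA γ E A F J)ᴴ = ∑ J, gamma2 γ I J * superA γ E A F J := by
  obtain ⟨hc, h0, hs⟩ := hγ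
  have sq : ∀ i : Fin 3, γ i.succ * γ i.succ = -1 := by
    intro i
    have h := hc i.succ i.succ
    simp only [if_true, Fin.succ_ne_zero, if_false, ← two_smul ℂ (γ i.succ * γ i.succ)] at h
    have h2 := congrArg (fun M => (1 / 2 : ℂ) • M) h
    simp only [smul_smul] at h2
    norm_num at h2
    exact h2
  have anti : ∀ a b : Fin 4, a ≠ b → γ a * γ b = -(γ b * γ a) := by
    intro a b hab
    have h := hc a b
    rw [if_neg hab] at h
    exact eq_neg_of_add_eq_zero_left h
  have aa : γ 1 * γ 1 = -1 := sq 0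
  have bb : γ 2 * γ 2 = -1 := sq 1
  have cc : γ 3 * γ 3 = -1 := sq 2
  have ag := anti 1 0 (by decide)
  have bg := anti 2 0 (by decide)
  have cg := anti 3 0 (by decide)
  have ba := anti 2 1 (by decide)
  have ca := anti 3 1 (by decide)
  have cb := anti 3 2 (by decide)
  have ha := hs 1 (by decide)
  have hb := hs 2 (by decide)
  have hcc := hs 3 (by decide)
  have F0 : ∀ i, F i i = 0 := fun i => by linarith [hF i i]
  have F1 := hF 1 0
  have F2 := hF 2 0
  have F3 := hF 2 1
  have s0 : (0 : Fin 3).succ = (1 : Fin 4) := rfl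
  have s1 : (1 : Fin 3).succ = (2 : Fin 4) := rfl
  have s2 : (2 : Fin 3).succ = (3 : Fin 4) := rfl
  have l : ∀ x y z : Matrix (Fin N) (Fin N) ℂ, x * y = z → ∀ w, x * (y * w) = z * w := by
    intro x y z h w
    rw [← h, mul_assoc]
  have aa' := l _ _ _ aa
  have bb' := l _ _ _ bb
  have cc' := l _ _ _ cc
  have ag' := l _ _ _ ag
  have bg' := l _ _ _ bg
  have cg' := l _ _ _ cg
  have ba' := l _ _ _ ba
  have ca' := l _ _ _ ca
  have cb' := l _ _ _ cb
  have key : ∀ I : Fin 3, (∑ J, gamma2 γ I J * superA γ E A F J =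
        -((E I : ℂ)) • γ 0 - ∑ J, ∑ K, ((F J K / 2 : ℝ) : ℂ) • gamma3 γ I J K +
          ∑ J, (Complex.I * (A J : ℂ)) • gamma2 γ I J) := by
    intro I
    fin_cases I <;>
    · simp [gamma2, gamma3, superA, Fin.sum_univ_three, s0, s1, s2, F0, F1, F2, F3, mul_add, add_mul, mul_sub, sub_mul, mul_assoc, aa, bb, cc, ag, bg, cg, ba, ca, cb, aa', bb', cc', ag', bg', cg', ba', ca', cb', -neg_smul]
      module
  intro I
  refine ⟨key I, ?_⟩
  rw [key I]
  fin_cases I <;>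
  · simp [gamma2, gamma3, Fin.sum_univ_three, s0, s1, s2, F0, F1, F2, F3, mul_assoc, h0, ha, hb, hcc, aa, bb, cc, ag, bg, cg, ba, ca, cb, aa', bb', cc', ag', bg', cg', ba', ca', cb', -neg_smul]
    try module
end

section
/- Let γ⁰, γ¹, γ², γ³ be a 4D gamma representation on ℂ^N. Let E_I, A_I (I = 1,2,3) be real numbers and F_{IJ} (I,J ∈ {1,2,3}) be real and antisymmetric, and define 𝒜_I := ½ Σ_J E_J γ⁰γ^Jγ^I − ¼ Σ_{J,K} F_{JK} γ^{JK}γ^I + i A_I·1, where γ^{JK} := ½(γ^Jγ^K − γ^Kγ^J) and all sums run over {1,2,3}. Then Σ_I γ^I𝒜_I = −½ Σ_I E_I γ⁰γ^I − ¼ Σ_{I,J} F_{IJ} γ^{IJ} + i Σ_I A_I γ^I, and consequently Σ_I γ^I𝒜_I − (Σ_I γ^I𝒜_I)† = −½ Σ_{I,J} F_{IJ} γ^{IJ}. -/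
open Matrix

theorem gamma_sum1 {N : ℕ} {γ : Fin 4 → Matrix (Fin N) (Fin N) ℂ}
    (hγ : IsGammaRep4 γ) :
    (∀ a : Fin 3, γ a.succ * γ a.succ = -1) ∧
    (∀ a : Fin 3, γ a.succ * γ 0 = -(γ 0 * γ a.succ)) ∧
    (∀ a b : Fin 3, a ≠ b → γ a.succ * γ b.succ = -(γ b.succ * γ a.succ)) := by
  obtain ⟨h, -, -⟩ := hγ
  refine ⟨fun a => ?_, fun a => ?_, fun a b hab => ?_⟩
  · have h1 := h a.succ a.succ
    simp only [if_true, Fin.succ_ne_zero, if_false, mul_one] at h1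
    have h2 : (2 : ℂ) • (γ a.succ * γ a.succ) = (2 : ℂ) • (-1) := by
      rw [two_smul, h1]; module
    exact smul_right_injective _ (two_ne_zero : (2 : ℂ) ≠ 0) h2
  · have h1 := h a.succ 0
    rw [if_neg (Fin.succ_ne_zero a)] at h1
    exact eq_neg_of_add_eq_zero_left h1
  · have h1 := h a.succ b.succ
    rw [if_neg (fun e => hab (Fin.succ_injective _ e))] at h1
    exact eq_neg_of_add_eq_zero_left h1

theorem gamma_sum2 {N : ℕ} {γ : Fin 4 → Matrix (Fin N) (Fin N) ℂ}
    (hγ : IsGammaRep4 γ) (J : Fin 3) :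
    ∑ I : Fin 3, γ I.succ * γ J.succ * γ I.succ = γ J.succ := by
  obtain ⟨sq, -, ac⟩ := gamma_sum1 hγ
  have key : ∀ I, γ I.succ * γ J.succ * γ I.succ =
      if I = J then -γ J.succ else γ J.succ := by
    intro I
    split_ifs with h
    · subst h; rw [sq]; simp
    · rw [ac I J h, neg_mul, mul_assoc, sq]; simp
  simp only [key, Fin.sum_univ_three]
  fin_cases J <;> simp

theorem gamma_sum3 {N : ℕ} {γ : Fin 4 → Matrix (Fin N) (Fin N) ℂ}
    (hγ : IsGammaRep4 γ) (J K : Fin 3) :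
    ∑ I : Fin 3, γ I.succ * (gamma2 γ J K * γ I.succ) = gamma2 γ J K := by
  obtain ⟨sq, -, ac⟩ := gamma_sum1 hγ
  by_cases hJK : J = K
  · subst hJK; simp [gamma2]
  have hg : gamma2 γ J K = γ J.succ * γ K.succ := by
    rw [gamma2, ac K J (Ne.symm hJK)]; module
  have key : ∀ I, γ I.succ * (γ J.succ * γ K.succ * γ I.succ) =
      if I = J ∨ I = K then γ J.succ * γ K.succ else -(γ J.succ * γ K.succ) := by
    intro I
    split_ifs with h
    · rcases h with h | h
      · subst h
        rw [← mul_assoc, ← mul_assoc, sq, ac I K hJK]; simp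
      · subst h
        rw [mul_assoc, sq, ac J I hJK]; simp
    · push Not at h
      rw [← mul_assoc, ← mul_assoc, ac I J h.1, neg_mul, mul_assoc (γ J.succ), ac I K h.2,
        mul_neg, neg_neg, mul_assoc, mul_assoc, sq]
      simp
  simp only [hg, key, Fin.sum_univ_three]
  fin_cases J <;> fin_cases K <;> simp at hJK ⊢

theorem gamma_main {N : ℕ} {γ : Fin 4 → Matrix (Fin N) (Fin N) ℂ}
    (hγ : IsGammaRep4 γ) (E A : Fin 3 → ℝ) (F : Fin 3 → Fin 3 → ℝ) :
    ∑ I, γ I.succ * superA γ E A F I =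
      -((1 / 2 : ℂ) • ∑ I, (E I : ℂ) • (γ 0 * γ I.succ)) -
        (1 / 4 : ℂ) • ∑ I, ∑ J, (F I J : ℂ) • gamma2 γ I J +
        ∑ I, (Complex.I * (A I : ℂ)) • γ I.succ := by
  obtain ⟨sq, a0, ac⟩ := gamma_sum1 hγ
  simp only [superA, mul_add, mul_sub, Finset.sum_add_distrib, Finset.sum_sub_distrib,
    mul_smul_comm, mul_one, Finset.mul_sum, ← Finset.smul_sum]
  congr 1
  congr 1
  · rw [← smul_neg, Finset.sum_comm, ← Finset.sum_neg_distrib]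
    congr 1
    refine Finset.sum_congr rfl fun J _ => ?_
    rw [← Finset.smul_sum, ← smul_neg]
    congr 1
    have : ∀ I : Fin 3, γ I.succ * (γ 0 * γ J.succ * γ I.succ) =
        -(γ 0 * (γ I.succ * γ J.succ * γ I.succ)) := by
      intro I
      rw [← mul_assoc, ← mul_assoc, a0]; simp only [neg_mul, mul_assoc]
    simp only [this, Finset.sum_neg_distrib, ← Finset.mul_sum, gamma_sum2 hγ]
  · congr 1
    rw [Finset.sum_comm]
    refine Finset.sum_congr rfl fun J _ => ?_
    rw [Finset.sum_comm]
    refine Finset.sum_congr rfl fun K _ => ?_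
    rw [← Finset.smul_sum, gamma_sum3 hγ]

theorem stmt14 (N : ℕ) (hN : 1 ≤ N) (γ : Fin 4 → Matrix (Fin N) (Fin N) ℂ)
    (hγ : IsGammaRep4 γ) (E A : Fin 3 → ℝ) (F : Fin 3 → Fin 3 → ℝ)
    (hF : ∀ I J, F I J = -F J I) :
    (∑ I, γ I.succ * superA γ E A F I =
      -((1 / 2 : ℂ) • ∑ I, (E I : ℂ) • (γ 0 * γ I.succ)) -
        (1 / 4 : ℂ) • ∑ I, ∑ J, (F I J : ℂ) • gamma2 γ I J +
        ∑ I, (Complex.I * (A I : ℂ)) • γ I.succ) ∧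
    (∑ I, γ I.succ * superA γ E A F I) - (∑ I, γ I.succ * superA γ E A F I)ᴴ =
      -((1 / 2 : ℂ) • ∑ I, ∑ J, (F I J : ℂ) • gamma2 γ I J) := by
  refine ⟨gamma_main hγ E A F, ?_⟩
  obtain ⟨-, a0, -⟩ := gamma_sum1 hγ
  have h0 : (γ 0)ᴴ = γ 0 := hγ.2.1
  have hs : ∀ I : Fin 3, (γ I.succ)ᴴ = -γ I.succ := fun I => hγ.2.2 _ (Fin.succ_ne_zero I)
  have hg : ∀ I J : Fin 3, (gamma2 γ I J)ᴴ = -gamma2 γ I J := by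
    intro I J
    simp only [gamma2, conjTranspose_smul, conjTranspose_sub, conjTranspose_mul, hs, neg_mul_neg]
    rw [← smul_neg, neg_sub]
    simp
  rw [gamma_main hγ E A F]
  simp only [conjTranspose_add, conjTranspose_sub, conjTranspose_neg, conjTranspose_smul,
    conjTranspose_sum, conjTranspose_mul, hg, hs, h0, neg_mul, a0, neg_neg]
  simp only [star_mul', Complex.star_def, Complex.conj_ofReal, Complex.conj_I, map_div₀, map_one,
    map_ofNat, smul_neg, neg_smul, neg_mul, neg_neg, Finset.sum_neg_distrib]
  module
end
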